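/- Let (G_k) be a sequence of finite simple graphs such that: (i) for every r ∈ ℕ, the proportion of (3,r)-tree-like vertices of G_k tends to 1 as k → ∞; and (ii) the average degree 2·|E(G_k)|/|V(G_k)| tends to 3 as k → ∞. Then liminf_{k→∞} ( max{ size(S)/|V(G_k)| : S a bisection of G_k } ) > (3/(2π))·arccos(−2√2/3). -/

import Mathlib

open Filter Real

/-- `x` is a `(d,r)`-tree-like vertex of `H`: the subgraph induced on the ball of radius
`r` about `x` is acyclic, and every vertex at distance at most `r-1` from `x` has degree
exactly `d` in `H`. -/
def TreeLikeVtx {W : Type*} (H : SimpleGraph W) (d r : ℕ) (x : W) : Prop :=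
  (H.induce {y : W | H.Reachable x y ∧ H.dist x y ≤ r}).IsAcyclic ∧
    ∀ y : W, H.Reachable x y → H.dist x y + 1 ≤ r → (H.neighborSet y).ncard = d

/-- `S` is a bisection: its size and the size of its complement differ by at most 1. -/
def IsBisection {W : Type*} (S : Set W) : Prop :=
  S.ncard ≤ Sᶜ.ncard + 1 ∧ Sᶜ.ncard ≤ S.ncard + 1

/-- The size of the bisection `S`: the number of edges with exactly one endpoint in `S`. -/
noncomputable def bisectionSize {W : Type*} (H : SimpleGraph W) (S : Set W) : ℕ :=
  {e ∈ H.edgeSet | ∃ u v : W, e = s(u, v) ∧ u ∈ S ∧ v ∉ S}.ncard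

section Gaussian

open MeasureTheory ProbabilityTheory RealInnerProductSpace

variable {E : Type*} [NormedAddCommGroup E] [InnerProductSpace ℝ E] [FiniteDimensional ℝ E]
  [MeasurableSpace E] [BorelSpace E]

lemma charFunDual_gaussianReal_std (L : StrongDual ℝ ℝ) :
    charFunDual (gaussianReal 0 1) L = Complex.exp (-((L 1 : ℝ) : ℂ) ^ 2 / 2) := by
  have hL : ∀ x, L x = L 1 * x := fun x => by
    rw [mul_comm, ← smul_eq_mul, ← map_smul, smul_eq_mul, mul_one]
  have := charFun_gaussianReal (μ := 0) (v := 1) (L 1)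
  rw [charFun_apply_real] at this
  rw [charFunDual_apply]
  have h1 : ∀ v : ℝ, Complex.exp (L v * Complex.I) = Complex.exp (L 1 * v * Complex.I) :=
    fun v => by rw [hL v, Complex.ofReal_mul]
  simp_rw [h1, this]
  congr 1
  simp
  ring

/-- The joint law of two standard Gaussian linear functionals with correlation `c`. -/
lemma stdGaussian_map_inner_pair {a b : E} (ha : ‖a‖ = 1) (hb : ‖b‖ = 1) {s : ℝ}
    (hs : ⟪a, b⟫ ^ 2 + s ^ 2 = 1) :
    (stdGaussian E).map (fun g => (⟪a, g⟫, ⟪b, g⟫)) =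
      ((gaussianReal 0 1).prod (gaussianReal 0 1)).map
        (fun p => (p.1, ⟪a, b⟫ * p.1 + s * p.2)) := by
  set c := ⟪a, b⟫ with hc
  let f : E →L[ℝ] ℝ × ℝ := (innerSL ℝ a).prod (innerSL ℝ b)
  let h : ℝ × ℝ →L[ℝ] ℝ × ℝ := (ContinuousLinearMap.fst ℝ ℝ ℝ).prod
    (c • ContinuousLinearMap.fst ℝ ℝ ℝ + s • ContinuousLinearMap.snd ℝ ℝ ℝ)
  change (stdGaussian E).map f = ((gaussianReal 0 1).prod (gaussianReal 0 1)).map h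
  apply Measure.ext_of_charFunDual
  ext L
  rw [charFunDual_map, charFunDual_map, charFunDual_stdGaussian, charFunDual_prod,
    charFunDual_gaussianReal_std, charFunDual_gaussianReal_std, ← Complex.exp_add]
  have hL : ∀ x y : ℝ, L (x, y) = x * L (1, 0) + y * L (0, 1) := by
    intro x y
    have : ((x, y) : ℝ × ℝ) = x • (1, 0) + y • (0, 1) := by simp
    rw [this, map_add, map_smul, map_smul]; rfl
  have h1 : L ∘SL f = InnerProductSpace.toDual ℝ E (L (1, 0) • a + L (0, 1) • b) := by
    ext g
    simp [f, hL ⟪a, g⟫]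
    ring
  have h2 : ‖L ∘SL f‖ ^ 2 = (L (1, 0) + c * L (0, 1)) ^ 2 + (s * L (0, 1)) ^ 2 := by
    rw [h1, LinearIsometryEquiv.norm_map, norm_add_sq_real, norm_smul, norm_smul, ha, hb,
      inner_smul_left, inner_smul_right]
    simp only [norm_eq_abs, mul_one, sq_abs, ← hc, conj_trivial]
    linear_combination (-(L (0, 1)) ^ 2) * hs
  rw [← Complex.ofReal_pow, h2]
  have h3 : ((L ∘SL h) ∘SL ContinuousLinearMap.inl ℝ ℝ ℝ) 1 = L (1, 0) + c * L (0, 1) := by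
    simp [h, hL 1 c]
  have h4 : ((L ∘SL h) ∘SL ContinuousLinearMap.inr ℝ ℝ ℝ) 1 = s * L (0, 1) := by
    simp [h, hL 0 s]
  rw [h3, h4]
  push_cast
  ring_nf

lemma prod_gaussianReal_apply_of_polar {S : Set (ℝ × ℝ)} (hS : MeasurableSet S) {A : Set ℝ}
    (hA : MeasurableSet A)
    (h : ∀ r φ : ℝ, 0 < r → φ ∈ Set.Ioo (-π) π → ((r * cos φ, r * sin φ) ∈ S ↔ φ ∈ A)) :
    ((gaussianReal 0 1).prod (gaussianReal 0 1)) S =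
      ENNReal.ofReal (1 / (2 * π)) * volume (A ∩ Set.Ioo (-π) π) := by
  obtain ⟨K, hK⟩ : ∃ K : ENNReal, ∀ (S : Set (ℝ × ℝ)) (_ : MeasurableSet S) (A : Set ℝ)
      (_ : MeasurableSet A)
      (_ : ∀ r φ : ℝ, 0 < r → φ ∈ Set.Ioo (-π) π → ((r * cos φ, r * sin φ) ∈ S ↔ φ ∈ A)),
      ((gaussianReal 0 1).prod (gaussianReal 0 1)) S = K * volume (A ∩ Set.Ioo (-π) π) := by
    refine ⟨∫⁻ r in Set.Ioi (0 : ℝ), ENNReal.ofReal r *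
      ENNReal.ofReal ((√(2 * π))⁻¹ * (√(2 * π))⁻¹ * exp (-r ^ 2 / 2)), ?_⟩
    intro S hS A hA h
    rw [gaussianReal_of_var_ne_zero 0 one_ne_zero, prod_withDensity (by fun_prop) (by fun_prop),
      withDensity_apply _ hS, ← lintegral_indicator hS, ← Measure.volume_eq_prod,
      ← lintegral_comp_polarCoord_symm, polarCoord_target, Measure.volume_eq_prod,
      ← Measure.prod_restrict]
    have hvol : volume (A ∩ Set.Ioo (-π) π) =
        ∫⁻ φ in Set.Ioo (-π) π, A.indicator (fun _ => 1) φ := by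
      rw [lintegral_indicator hA, lintegral_one, Measure.restrict_restrict hA,
        Measure.restrict_apply_univ]
    rw [hvol, ← lintegral_prod_mul (by fun_prop)
      ((measurable_const.indicator hA).aemeasurable), Measure.prod_restrict]
    refine setLIntegral_congr_fun (measurableSet_Ioi.prod measurableSet_Ioo) ?_
    rintro ⟨r, φ⟩ ⟨hr, hφ⟩
    have hr' : (0 : ℝ) < r := hr
    simp only [polarCoord_symm_apply, smul_eq_mul]
    by_cases hm : φ ∈ A
    · rw [Set.indicator_of_mem ((h r φ hr' hφ).2 hm), Set.indicator_of_mem hm, mul_one]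
      congr 1
      simp only [gaussianPDF_def, gaussianPDFReal_def]
      rw [← ENNReal.ofReal_mul (by positivity)]
      congr 1
      have : exp (-r ^ 2 / 2) = exp (-(r * cos φ) ^ 2 / 2) * exp (-(r * sin φ) ^ 2 / 2) := by
        rw [← exp_add]
        congr 1
        linear_combination (r ^ 2 / 2) * (sin_sq_add_cos_sq φ)
      simp [this]
      ring
    · rw [Set.indicator_of_notMem (fun hh => hm ((h r φ hr' hφ).1 hh)),
        Set.indicator_of_notMem hm]
      simp
  have h1 := hK Set.univ MeasurableSet.univ Set.univ MeasurableSet.univ (by simp)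
  rw [hK S hS A hA h]
  congr 1
  rw [measure_univ, Set.univ_inter, Real.volume_Ioo] at h1
  rw [one_div, ENNReal.ofReal_inv_of_pos (by positivity)]
  refine ENNReal.eq_inv_of_mul_eq_one_left ?_
  rw [h1]
  ring_nf

lemma stdGaussian_inner_pos_neg_of_unit {a b : E} (ha : ‖a‖ = 1) (hb : ‖b‖ = 1) :
    (stdGaussian E) {g | 0 < ⟪a, g⟫ ∧ ⟪b, g⟫ < 0} =
      ENNReal.ofReal (InnerProductGeometry.angle a b / (2 * π)) := by
  set θ := InnerProductGeometry.angle a b with hθ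
  have hcos : ⟪a, b⟫ = cos θ := by
    rw [hθ, InnerProductGeometry.cos_angle, ha, hb]; simp
  have h0 : 0 ≤ θ := InnerProductGeometry.angle_nonneg a b
  have h1 : θ ≤ π := InnerProductGeometry.angle_le_pi a b
  have hS : MeasurableSet {p : ℝ × ℝ | 0 < p.1 ∧ p.2 < 0} :=
    (measurableSet_lt measurable_const measurable_fst).inter
      (measurableSet_lt measurable_snd measurable_const)
  have hm : Measurable (fun g : E => (⟪a, g⟫, ⟪b, g⟫)) := by fun_prop
  have hm' : Measurable (fun p : ℝ × ℝ => (p.1, ⟪a, b⟫ * p.1 + sin θ * p.2)) := by fun_prop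
  have key := congrArg (fun m => m {p : ℝ × ℝ | 0 < p.1 ∧ p.2 < 0})
    (stdGaussian_map_inner_pair ha hb (s := sin θ) (by rw [hcos]; exact cos_sq_add_sin_sq θ))
  simp only [Measure.map_apply hm hS, Measure.map_apply hm' hS] at key
  refine key.trans ?_
  rw [prod_gaussianReal_apply_of_polar (hm' hS) (A := Set.Ioo (-(π / 2)) (θ - π / 2))
    measurableSet_Ioo]
  · rw [Set.inter_eq_left.2, Real.volume_Ioo, ← ENNReal.ofReal_mul (by positivity)]
    · congr 1; ring
    · intro φ hφ
      constructor <;> linarith [hφ.1, hφ.2, pi_pos]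
  · intro r φ hr hφ
    have e : ⟪a, b⟫ * (r * cos φ) + sin θ * (r * sin φ) = r * cos (φ - θ) := by
      rw [hcos, cos_sub]; ring
    have hneg {t x : ℝ} (ht : 0 < t) : t * x < 0 ↔ x < 0 := by simp [mul_neg_iff, ht, ht.le]
    simp only [Set.mem_preimage, Set.mem_ofPred_eq, e, Set.mem_Ioo]
    rw [mul_pos_iff_of_pos_left hr, hneg hr]
    constructor
    · rintro ⟨hc, hc'⟩
      have hl : -(π / 2) < φ := by
        by_contra! hcon
        have := cos_nonpos_of_pi_div_two_le_of_le (x := -φ) (by linarith) (by linarith [hφ.1])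
        rw [cos_neg] at this; linarith
      have hu : φ < π / 2 := by
        by_contra! hcon
        have := cos_nonpos_of_pi_div_two_le_of_le (x := φ) (by linarith) (by linarith [hφ.2])
        linarith
      refine ⟨hl, ?_⟩
      by_contra! hcon
      have := cos_nonneg_of_neg_pi_div_two_le_of_le (x := φ - θ) (by linarith) (by linarith)
      linarith
    · rintro ⟨hl, hu⟩
      refine ⟨cos_pos_of_mem_Ioo ⟨hl, by linarith⟩, ?_⟩
      rw [← cos_neg]
      exact cos_neg_of_pi_div_two_lt_of_lt (by linarith) (by linarith)

lemma stdGaussian_inner_pos_neg {a b : E} (ha : a ≠ 0) (hb : b ≠ 0) :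
    (stdGaussian E) {g | 0 < ⟪a, g⟫ ∧ ⟪b, g⟫ < 0} =
      ENNReal.ofReal (InnerProductGeometry.angle a b / (2 * π)) := by
  have ha' : 0 < ‖a‖⁻¹ := by positivity
  have hb' : 0 < ‖b‖⁻¹ := by positivity
  have := stdGaussian_inner_pos_neg_of_unit (E := E) (norm_smul_inv_norm (𝕜 := ℝ) ha)
    (norm_smul_inv_norm (𝕜 := ℝ) hb)
  simp only [RCLike.ofReal_real_eq_id, id_eq] at this
  rw [InnerProductGeometry.angle_smul_left_of_pos _ _ ha',
    InnerProductGeometry.angle_smul_right_of_pos _ _ hb'] at this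
  rw [← this]
  congr 1
  ext g
  have hneg {t x : ℝ} (ht : 0 < t) : t * x < 0 ↔ x < 0 := by simp [mul_neg_iff, ht, ht.le]
  simp only [Set.mem_ofPred_eq, real_inner_smul_left]
  rw [mul_pos_iff_of_pos_left ha', hneg hb']

lemma stdGaussian_inner_eq_zero {a : E} (ha : a ≠ 0) :
    (stdGaussian E) {g | ⟪a, g⟫ = 0} = 0 := by
  have hmap := IsGaussian.map_eq_gaussianReal (μ := stdGaussian E) (innerSL ℝ a)
  have hv : Var[innerSL ℝ a; stdGaussian E].toNNReal ≠ 0 := by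
    rw [variance_dual_stdGaussian, innerSL_apply_norm, ne_eq, Real.toNNReal_eq_zero, not_le]
    positivity
  have := nullSingletonClass_gaussianReal (μ := ∫ x, innerSL ℝ a x ∂stdGaussian E) hv
  have h0 := measure_singleton (μ := (stdGaussian E).map (innerSL ℝ a)) (0 : ℝ) (self := hmap ▸ this)
  rwa [Measure.map_apply (by fun_prop) (measurableSet_singleton 0)] at h0

lemma measurable_realSign : Measurable Real.sign := by
  unfold Real.sign
  exact Measurable.ite measurableSet_Iio measurable_const
    (Measurable.ite measurableSet_Ioi measurable_const measurable_const)

/-- Sheppard's formula. -/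
lemma integral_sign_inner_mul_sign_inner {a b : E} (ha : a ≠ 0) (hb : b ≠ 0) :
    ∫ g, Real.sign ⟪a, g⟫ * Real.sign ⟪b, g⟫ ∂(stdGaussian E) =
      1 - 2 * InnerProductGeometry.angle a b / π := by
  set S : E → E → Set E := fun a b => {g | 0 < ⟪a, g⟫ ∧ ⟪b, g⟫ < 0} with hS
  have hSm : ∀ a b, MeasurableSet (S a b) := fun a b =>
    (measurableSet_lt (f := fun _ : E => (0 : ℝ)) (g := fun g => ⟪a, g⟫)
      (by fun_prop) (by fun_prop)).inter
      (measurableSet_lt (f := fun g => ⟪b, g⟫) (g := fun _ : E => (0 : ℝ))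
        (by fun_prop) (by fun_prop))
  have hreal : ∀ {a b : E}, a ≠ 0 → b ≠ 0 →
      ∫ g, (S a b).indicator (fun _ => (2 : ℝ)) g ∂(stdGaussian E) =
        InnerProductGeometry.angle a b / π := by
    intro a b ha hb
    rw [integral_indicator (hSm a b), setIntegral_const, measureReal_def,
      stdGaussian_inner_pos_neg ha hb, ENNReal.toReal_ofReal
        (div_nonneg (InnerProductGeometry.angle_nonneg a b) (by positivity)), smul_eq_mul]
    field_simp
  have hInt : ∀ a b, Integrable ((S a b).indicator (fun _ => (2 : ℝ))) (stdGaussian E) :=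
    fun a b => (integrable_const _).indicator (hSm a b)
  have hae : (fun g => Real.sign ⟪a, g⟫ * Real.sign ⟪b, g⟫) =ᵐ[stdGaussian E]
      fun g => 1 - (S a b).indicator (fun _ => (2 : ℝ)) g
        - (S b a).indicator (fun _ => (2 : ℝ)) g := by
    have h1 : ∀ᵐ g ∂(stdGaussian E), ⟪a, g⟫ ≠ 0 := by
      simpa [ae_iff] using stdGaussian_inner_eq_zero ha
    have h2 : ∀ᵐ g ∂(stdGaussian E), ⟪b, g⟫ ≠ 0 := by
      simpa [ae_iff] using stdGaussian_inner_eq_zero hb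
    filter_upwards [h1, h2] with g hg1 hg2
    simp only [Set.indicator_apply, hS, Set.mem_ofPred_eq]
    rcases lt_or_gt_of_ne hg1 with h | h <;> rcases lt_or_gt_of_ne hg2 with h' | h' <;>
      simp [Real.sign_of_neg, Real.sign_of_pos, h, h', h.not_gt, h'.not_gt] <;> norm_num
  rw [integral_congr_ae hae, integral_sub (f := fun g => 1 - (S a b).indicator (fun _ => (2 : ℝ)) g)
      ((integrable_const _).sub (hInt a b)) (hInt b a),
    integral_sub (integrable_const _) (hInt a b), hreal ha hb, hreal hb ha,
    InnerProductGeometry.angle_comm b a]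
  simp
  ring

end Gaussian

section Tree

variable {V : Type*} {H : SimpleGraph V}

/-- `w` is reachable from `u`, at distance exactly `k`. -/
def AtDist (H : SimpleGraph V) (k : ℕ) (u w : V) : Prop := H.Reachable u w ∧ H.dist u w = k

namespace AtDist

lemma unique {k l : ℕ} {u w : V} (h : AtDist H k u w) (h' : AtDist H l u w) : k = l :=
  h.2.symm.trans h'.2

lemma self (u : V) : AtDist H 0 u u := ⟨.rfl, by simp⟩

lemma eq_of_zero {u w : V} (h : AtDist H 0 u w) : u = w := h.1.dist_eq_zero_iff.1 h.2

lemma symm {k : ℕ} {u w : V} (h : AtDist H k u w) : AtDist H k w u :=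
  ⟨h.1.symm, by rw [SimpleGraph.dist_comm, h.2]⟩

lemma of_adj {u w : V} (h : H.Adj u w) : AtDist H 1 u w :=
  ⟨h.reachable, SimpleGraph.dist_eq_one_iff_adj.2 h⟩

lemma step {k : ℕ} {u w w' : V} (h : AtDist H k u w) (hw : H.Adj w w') :
    ∃ l, AtDist H l u w' ∧ l ≤ k + 1 ∧ k ≤ l + 1 := by
  refine ⟨_, ⟨h.1.trans hw.reachable, rfl⟩, ?_⟩
  have := hw.diff_dist_adj (u := u)
  have := h.2
  omega

lemma pred {k : ℕ} {u w : V} (h : AtDist H (k + 1) u w) : ∃ p, H.Adj p w ∧ AtDist H k u p := by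
  obtain ⟨p, hp⟩ := h.1.symm.exists_walk_length_eq_dist
  rw [SimpleGraph.dist_comm, h.2] at hp
  cases p with
  | nil => simp at hp
  | cons hadj q =>
    rename_i x
    simp only [SimpleGraph.Walk.length_cons, add_left_inj] at hp
    refine ⟨x, hadj.symm, q.reachable.symm, ?_⟩
    have h1 := SimpleGraph.dist_le q
    rw [SimpleGraph.dist_comm] at h1
    have := hadj.diff_dist_adj (u := u)
    have := h.2
    omega

lemma triangle {k l : ℕ} {u v w : V} (h : AtDist H k u w) (h' : AtDist H l v w) :
    ∃ m ≤ k + l, AtDist H m u v := by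
  obtain ⟨p, hp⟩ := h.1.exists_walk_length_eq_dist
  obtain ⟨q, hq⟩ := h'.1.exists_walk_length_eq_dist
  refine ⟨_, ?_, (p.append q.reverse).reachable, rfl⟩
  refine (SimpleGraph.dist_le (p.append q.reverse)).trans_eq ?_
  rw [SimpleGraph.Walk.length_append, SimpleGraph.Walk.length_reverse, hp, hq, h.2, h'.2]

end AtDist

namespace TreeLikeVtx

variable {n R : ℕ} {v : V}

lemma exists_induce_walk {k : ℕ} {w : V} (hk : k ≤ R) (h : AtDist H k v w) :
    ∃ p : (H.induce {y : V | H.Reachable v y ∧ H.dist v y ≤ R}).Walk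
      ⟨v, ⟨.rfl, by simp⟩⟩ ⟨w, ⟨h.1, h.2.trans_le hk⟩⟩, p.length = k := by
  induction k generalizing w with
  | zero =>
    obtain rfl := h.eq_of_zero
    exact ⟨.nil, rfl⟩
  | succ k ih =>
    obtain ⟨p, hp, hp'⟩ := h.pred
    obtain ⟨q, hq⟩ := ih (by omega) hp'
    exact ⟨q.concat hp, (SimpleGraph.Walk.length_concat _ _).trans (by rw [hq])⟩

lemma atDist_induce {k : ℕ} {w : V} (hk : k ≤ R) (h : AtDist H k v w) :
    AtDist (H.induce {y : V | H.Reachable v y ∧ H.dist v y ≤ R}) k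
      ⟨v, ⟨.rfl, by simp⟩⟩ ⟨w, ⟨h.1, h.2.trans_le hk⟩⟩ := by
  obtain ⟨p, hp⟩ := exists_induce_walk hk h
  refine ⟨p.reachable, le_antisymm ((SimpleGraph.dist_le p).trans_eq hp) ?_⟩
  obtain ⟨q, hq⟩ := p.reachable.exists_walk_length_eq_dist
  have := SimpleGraph.dist_le (q.map (SimpleGraph.Embedding.induce _).toHom)
  rw [SimpleGraph.Walk.length_map, hq] at this
  exact h.2.symm.trans_le this

lemma not_adj_of_atDist_eq (hv : TreeLikeVtx H n R v) {k : ℕ} {y y' : V} (hk : k ≤ R)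
    (h : AtDist H k v y) (h' : AtDist H k v y') : ¬ H.Adj y y' := by
  intro hadj
  have h1 := atDist_induce hk h
  have h2 := atDist_induce hk h'
  exact hv.1.dist_ne_of_adj (v := ⟨y, ⟨h.1, h.2.trans_le hk⟩⟩)
    (w := ⟨y', ⟨h'.1, h'.2.trans_le hk⟩⟩) hadj h1.1 (h1.2.trans h2.2.symm)

lemma parent_unique (hv : TreeLikeVtx H n R v) {k : ℕ} {y p p' : V} (hk : k + 1 ≤ R)
    (hy : AtDist H (k + 1) v y) (hp : AtDist H k v p) (hp' : AtDist H k v p')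
    (ha : H.Adj p y) (ha' : H.Adj p' y) : p = p' := by
  classical
  have hy' := atDist_induce hk hy
  obtain ⟨q, hq, -⟩ := hy'.1.exists_path_of_dist
  have key : ∀ {p : V} (hp : AtDist H k v p) (_ : H.Adj p y),
      (⟨p, ⟨hp.1, hp.2.trans_le (by omega)⟩⟩ :
        {y : V | H.Reachable v y ∧ H.dist v y ≤ R}) = q.penultimate := by
    intro p hp ha
    have h1 := atDist_induce (R := R) (by omega) hp
    obtain ⟨P, hP, hP'⟩ := h1.1.exists_path_of_dist
    refine hv.1.eq_penultimate_of_adj_end hq ha.symm ?_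
    by_contra hmem
    have := hv.1.mem_support_of_ne_mem_support_of_adj_of_isPath hP hq ha hmem
    have h2 := SimpleGraph.dist_le (P.takeUntil _ this)
    have h3 := P.length_takeUntil_le_length this
    have h4 := hy'.2
    have h5 := h1.2
    omega
  exact congrArg Subtype.val ((key hp ha).trans (key hp' ha').symm)

lemma not_atDist_of_adj (hv : TreeLikeVtx H n R v) {u : V} (hu : H.Adj v u) :
    ∀ {k : ℕ} {w : V}, k ≤ R → AtDist H k v w → ¬ AtDist H k u w := by
  intro k
  induction k with
  | zero =>
    intro w _ h h'
    exact hu.ne (h.eq_of_zero.trans h'.eq_of_zero.symm)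
  | succ k ih =>
    intro w hk h h'
    obtain ⟨p, hp, hp'⟩ := h'.pred
    obtain ⟨l, hl, hl1, hl2⟩ := h.step hp.symm
    obtain ⟨m, hm, hm1, hm2⟩ := hp'.symm.step hu.symm
    obtain rfl := hl.unique hm.symm
    have : l ≠ k + 1 := by
      rintro rfl
      exact hv.not_adj_of_atDist_eq hk hl h hp
    obtain rfl : l = k := by omega
    exact ih (by omega) hl hp'

lemma branch_unique (hv : TreeLikeVtx H n R v) {u u' : V} (hu : H.Adj v u) (hu' : H.Adj v u') :
    ∀ {d : ℕ} {w : V}, d + 1 ≤ R → AtDist H (d + 1) v w → AtDist H d u w → AtDist H d u' w →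
      u = u' := by
  intro d
  induction d with
  | zero =>
    intro w _ _ h h'
    exact h.eq_of_zero.trans h'.eq_of_zero.symm
  | succ d ih =>
    intro w hd hw h h'
    have key : ∀ {u : V}, H.Adj v u → AtDist H (d + 1) u w →
        ∃ p, H.Adj p w ∧ AtDist H d u p ∧ AtDist H (d + 1) v p := by
      intro u hu h
      obtain ⟨p, hp, hp'⟩ := h.pred
      obtain ⟨l, hl, hl1, hl2⟩ := hw.step hp.symm
      obtain ⟨m, hm, hm1, hm2⟩ := hp'.symm.step hu.symm
      obtain rfl := hl.unique hm.symm
      obtain rfl : l = d + 1 := by omega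
      exact ⟨p, hp, hp', hl⟩
    obtain ⟨p, hp1, hp2, hp3⟩ := key hu h
    obtain ⟨p', hp1', hp2', hp3'⟩ := key hu' h'
    obtain rfl := hv.parent_unique hd hw hp3 hp3' hp1 hp1'
    exact ih (by omega) hp3 hp2 hp2'

lemma atDist_other_branch (hv : TreeLikeVtx H n R v) {u u' : V} (hu : H.Adj v u)
    (hu' : H.Adj v u') (hne : u ≠ u') {d : ℕ} {w : V} (hd : d + 1 ≤ R)
    (hw : AtDist H (d + 1) v w) (h : AtDist H d u w) : AtDist H (d + 2) u' w := by
  obtain ⟨l, hl, hl1, hl2⟩ := hw.symm.step hu'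
  have h1 : l ≠ d := by
    rintro rfl
    exact hne (hv.branch_unique hu hu' hd hw h hl.symm)
  have h2 : l ≠ d + 1 := by
    rintro rfl
    exact hv.not_atDist_of_adj hu' hd hw hl.symm
  obtain rfl : l = d + 2 := by omega
  exact hl.symm

lemma exists_neighbors (hv : TreeLikeVtx H 3 R v) (hR : 1 ≤ R) :
    ∃ u : Fin 3 → V, Function.Injective u ∧ ∀ w, H.Adj v w ↔ ∃ i, u i = w := by
  have h := hv.2 v .rfl (by simpa using hR)
  obtain ⟨x, y, z, hxy, hxz, hyz, hs⟩ := Set.ncard_eq_three.1 h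
  refine ⟨![x, y, z], ?_, ?_⟩
  · intro i j
    fin_cases i <;> fin_cases j <;> simp [hxy, hxz, hyz, hxy.symm, hxz.symm, hyz.symm]
  · intro w
    rw [← SimpleGraph.mem_neighborSet, hs]
    simp [Fin.exists_fin_succ, eq_comm]

end TreeLikeVtx

section Branch

variable [Fintype V] {n R : ℕ} {v : V}

open Classical in
/-- The vertices at distance `d + 1` from `v` and distance `d` from its neighbour `u`. -/
noncomputable def branch (H : SimpleGraph V) (v u : V) (d : ℕ) : Finset V :=
  {w | AtDist H (d + 1) v w ∧ AtDist H d u w}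

lemma mem_branch {u w : V} {d : ℕ} :
    w ∈ branch H v u d ↔ AtDist H (d + 1) v w ∧ AtDist H d u w := by simp [branch]

lemma exists_mem_branch {k : ℕ} {w : V} (h : AtDist H (k + 1) v w) :
    ∃ u, H.Adj v u ∧ w ∈ branch H v u k := by
  obtain ⟨u, hu, hu'⟩ := h.symm.pred
  exact ⟨u, hu.symm, mem_branch.2 ⟨h, hu'.symm⟩⟩

lemma TreeLikeVtx.card_branch (hv : TreeLikeVtx H 3 R v) {u : V} (hu : H.Adj v u) :
    ∀ {d : ℕ}, d + 1 ≤ R → (branch H v u d).card = 2 ^ d := by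
  classical
  intro d
  induction d with
  | zero =>
    intro _
    rw [pow_zero, Finset.card_eq_one]
    refine ⟨u, ?_⟩
    ext w
    rw [mem_branch, Finset.mem_singleton]
    constructor
    · exact fun h => h.2.eq_of_zero.symm
    · rintro rfl
      exact ⟨.of_adj hu, .self _⟩
  | succ d ih =>
    intro hd
    have key := Finset.card_mul_eq_card_mul (s := branch H v u d) (t := branch H v u (d + 1))
      (fun a b => H.Adj a b) (m := 2) (n := 1) ?_ ?_
    · rw [mul_one, ih (by omega)] at key
      rw [← key, pow_succ]
    · intro w hw
      rw [mem_branch] at hw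
      obtain ⟨p, hp, hp'⟩ := hw.1.pred
      have h3 : (H.neighborSet w).toFinset.card = 3 := by
        rw [← Set.ncard_eq_toFinset_card']
        exact hv.2 w hw.1.1 (by rw [hw.1.2]; omega)
      have : Finset.bipartiteAbove (fun a b => H.Adj a b) (branch H v u (d + 1)) w =
          (H.neighborSet w).toFinset.erase p := by
        ext y
        simp only [Finset.mem_bipartiteAbove, mem_branch, Finset.mem_erase, Set.mem_toFinset,
          SimpleGraph.mem_neighborSet]
        constructor
        · rintro ⟨⟨h1, h2⟩, h3⟩
          refine ⟨?_, h3⟩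
          rintro rfl
          have := h1.unique hp'
          omega
        · rintro ⟨h1, h2⟩
          obtain ⟨l, hl, hl1, hl2⟩ := hw.1.step h2
          have h4 : l ≠ d + 1 := by
            rintro rfl
            exact hv.not_adj_of_atDist_eq (by omega) hw.1 hl h2
          have h5 : l ≠ d := by
            rintro rfl
            exact h1 (hv.parent_unique (by omega) hw.1 hl hp' h2.symm hp)
          obtain rfl : l = d + 1 + 1 := by omega
          obtain ⟨m, hm, hm1, hm2⟩ := hw.2.step h2
          obtain ⟨m', hm', hm1', hm2'⟩ := hm.symm.step hu.symm
          obtain rfl := hl.unique hm'.symm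
          obtain rfl : m = d + 1 := by omega
          exact ⟨⟨hl, hm⟩, h2⟩
      rw [this, Finset.card_erase_of_mem (by simpa using hp.symm), h3]
    · intro w hw
      rw [mem_branch] at hw
      obtain ⟨p, hp, hp'⟩ := hw.2.pred
      obtain ⟨l, hl, hl1, hl2⟩ := hw.1.step hp.symm
      obtain ⟨m, hm, hm1, hm2⟩ := hp'.symm.step hu.symm
      obtain rfl := hl.unique hm.symm
      obtain rfl : l = d + 1 := by omega
      rw [Finset.card_eq_one]
      refine ⟨p, ?_⟩
      ext y
      simp only [Finset.mem_bipartiteBelow, mem_branch, Finset.mem_singleton]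
      constructor
      · rintro ⟨⟨h1, h2⟩, h3⟩
        exact hv.parent_unique hd hw.1 h1 hl h3 hp
      · rintro rfl
        exact ⟨⟨hl, hp'⟩, hp⟩

/-- Summation over a tree-like ball, for functions constant on each generation of each branch. -/
lemma TreeLikeVtx.sum_eq (hv : TreeLikeVtx H 3 R v) {u : Fin 3 → V}
    (hinj : Function.Injective u) (hu : ∀ w, H.Adj v w ↔ ∃ i, u i = w) {m : ℕ} (hm : m ≤ R)
    {f : V → ℝ} {φ : Fin 3 → ℕ → ℝ} (hf : ∀ w, f w ≠ 0 → ∃ k ≤ m, AtDist H k v w)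
    (hφ : ∀ i, ∀ d < m, ∀ w ∈ branch H v (u i) d, f w = φ i d) :
    ∑ w, f w = f v + ∑ i, ∑ d ∈ Finset.range m, 2 ^ d * φ i d := by
  classical
  have hadj : ∀ i, H.Adj v (u i) := fun i => (hu _).2 ⟨i, rfl⟩
  set B : Finset V := (Finset.univ ×ˢ Finset.range m).biUnion
    (fun q : Fin 3 × ℕ => branch H v (u q.1) q.2) with hB
  have hvB : v ∉ B := by
    simp only [hB, Finset.mem_biUnion, not_exists, not_and]
    intro q _ hq
    have := (mem_branch.1 hq).1.unique (.self v)
    omega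
  have hsub : ∑ w ∈ insert v B, f w = ∑ w, f w := by
    refine Finset.sum_subset (Finset.subset_univ _) ?_
    intro w _ hw
    by_contra hne
    obtain ⟨k, hk, hkw⟩ := hf w hne
    refine hw ?_
    rcases k with _ | k
    · simp [hkw.eq_of_zero]
    · obtain ⟨x, hx, hx'⟩ := exists_mem_branch hkw
      obtain ⟨i, rfl⟩ := (hu x).1 hx
      refine Finset.mem_insert_of_mem (Finset.mem_biUnion.2 ⟨(i, k), ?_, hx'⟩)
      simp; omega
  rw [← hsub, Finset.sum_insert hvB, hB, Finset.sum_biUnion, Finset.sum_product]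
  · congr 1
    refine Finset.sum_congr rfl fun i _ => Finset.sum_congr rfl fun d hd => ?_
    have hd' := Finset.mem_range.1 hd
    rw [Finset.sum_congr rfl (hφ i d hd'), Finset.sum_const,
      hv.card_branch (hadj i) (by omega)]
    simp
  · rintro ⟨i, d⟩ hid ⟨j, e⟩ hje hne
    refine Finset.disjoint_left.2 fun w h1 h2 => hne ?_
    rw [mem_branch] at h1 h2
    have hde : d = e := by simpa using h1.1.unique h2.1
    subst hde
    simp only [Finset.coe_product, Finset.coe_univ, Finset.coe_range, Set.mem_prod, Set.mem_univ,
      Set.mem_Iio, true_and] at hid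
    rw [hinj (hv.branch_unique (hadj i) (hadj j) (by omega) h1.1 h1.2 h2.2)]

lemma TreeLikeVtx.card_ball (hv : TreeLikeVtx H 3 R v) {m : ℕ} (hm : m ≤ R) (hR : 1 ≤ R) :
    ({w | ∃ k ≤ m, AtDist H k v w} : Set V).ncard = 1 + 3 * ∑ d ∈ Finset.range m, 2 ^ d := by
  classical
  obtain ⟨u, hinj, hu⟩ := hv.exists_neighbors hR
  have h := hv.sum_eq hinj hu hm (f := fun w => if ∃ k ≤ m, AtDist H k v w then 1 else 0)
    (φ := fun _ _ => 1) (fun w hw => by by_contra hcon; exact hw (if_neg hcon)) ?_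
  · rw [if_pos ⟨0, by omega, .self v⟩, Finset.sum_boole] at h
    rw [Set.ncard_eq_toFinset_card']
    have h' : ((Finset.univ.filter fun w => ∃ k ≤ m, AtDist H k v w).card : ℝ) =
        ((1 + 3 * ∑ d ∈ Finset.range m, 2 ^ d : ℕ) : ℝ) := by
      rw [h]; push_cast; simp
    rw [← Nat.cast_injective h']
    congr 1
    ext; simp
  · intro i d hd w hw
    exact if_pos ⟨d + 1, by omega, (mem_branch.1 hw).1⟩

end Branch

end Tree

section Wave

open RealInnerProductSpace

/-- The radial coefficients of the truncated wave vectors. -/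
noncomputable def waveCoeff (r d : ℕ) : ℝ := if d ≤ r then (-(√2)⁻¹) ^ d else 0

lemma sum_waveCoeff_mul (s a b : ℕ) (hab : a ≤ b) (hb : b ≤ s + 2) :
    ∑ d ∈ Finset.range (s + 2), 2 ^ d * (waveCoeff (s + 1) (d + a) * waveCoeff (s + 1) (d + b)) =
      (s + 2 - b) * (-(√2)⁻¹) ^ (a + b) := by
  have key : ∀ d ∈ Finset.range (s + 2),
      2 ^ d * (waveCoeff (s + 1) (d + a) * waveCoeff (s + 1) (d + b)) =
        (if d < s + 2 - b then 1 else 0) * (-(√2)⁻¹) ^ (a + b) := by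
    intro d _
    by_cases h : d < s + 2 - b
    · rw [waveCoeff, waveCoeff, if_pos (by omega), if_pos (by omega), if_pos h]
      have h2 : (-(√2)⁻¹ : ℝ) ^ 2 = 2⁻¹ := by simp
      rw [← pow_add, show d + a + (d + b) = 2 * d + (a + b) by ring, pow_add _ (2 * d), pow_mul,
        h2, ← mul_assoc, ← mul_pow]
      norm_num
    · rw [waveCoeff, waveCoeff, if_neg (show ¬ d + b ≤ s + 1 by omega), if_neg h]
      simp
  rw [Finset.sum_congr rfl key, ← Finset.sum_mul, Finset.sum_boole]
  congr 1
  have : (Finset.range (s + 2)).filter (fun d => d < s + 2 - b) = Finset.range (s + 2 - b) := by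
    ext; simp; omega
  rw [this, Finset.card_range, Nat.cast_sub hb]
  push_cast
  ring

variable {V : Type*} [Fintype V] {H : SimpleGraph V}

open Classical in
/-- The truncated radial wave centred at `u`. -/
noncomputable def wave (H : SimpleGraph V) (r : ℕ) (u : V) : EuclideanSpace ℝ V :=
  WithLp.toLp 2 fun w => if H.Reachable u w then waveCoeff r (H.dist u w) else 0

lemma wave_apply {r k : ℕ} {u w : V} (h : AtDist H k u w) : wave H r u w = waveCoeff r k := by
  simp [wave, h.1, h.2]

lemma exists_atDist_of_wave_ne_zero {r : ℕ} {u w : V} (h : wave H r u w ≠ 0) :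
    ∃ k ≤ r, AtDist H k u w := by
  by_cases hr : H.Reachable u w
  · by_cases hd : H.dist u w ≤ r
    · exact ⟨_, hd, hr, rfl⟩
    · simp [wave, waveCoeff, hd] at h
  · simp [wave, hr] at h

lemma wave_ne_zero (H : SimpleGraph V) (r : ℕ) (u : V) : wave H r u ≠ 0 := by
  intro h
  have := wave_apply (r := r) (AtDist.self (H := H) u)
  simp [h, waveCoeff] at this

lemma inner_eq_sum (x y : EuclideanSpace ℝ V) : ⟪x, y⟫ = ∑ w, x w * y w := by
  simp [PiLp.inner_apply, mul_comm]

namespace TreeLikeVtx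

variable {s R : ℕ} {v : V} {u : Fin 3 → V}

lemma wave_neighbor_apply (hv : TreeLikeVtx H 3 R v) (hu : ∀ w, H.Adj v w ↔ ∃ i, u i = w)
    (hinj : Function.Injective u) {r : ℕ} (i j : Fin 3) {d : ℕ} (hd : d + 1 ≤ R) {w : V}
    (hw : w ∈ branch H v (u i) d) :
    wave H r (u j) w = waveCoeff r (if i = j then d else d + 2) := by
  rw [mem_branch] at hw
  split_ifs with h
  · exact wave_apply (h ▸ hw.2)
  · exact wave_apply (hv.atDist_other_branch ((hu _).2 ⟨i, rfl⟩) ((hu _).2 ⟨j, rfl⟩)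
      (fun h' => h (hinj h')) hd hw.1 hw.2)

lemma inner_wave_self (hv : TreeLikeVtx H 3 R v) (hR : s + 2 ≤ R) :
    ⟪wave H (s + 1) v, wave H (s + 1) v⟫ = 1 + 3 * (s + 1) / 2 := by
  obtain ⟨u, hinj, hu⟩ := hv.exists_neighbors (by omega)
  rw [inner_eq_sum, hv.sum_eq hinj hu (m := s + 2) hR
    (φ := fun _ d => waveCoeff (s + 1) (d + 1) * waveCoeff (s + 1) (d + 1))]
  · rw [wave_apply (AtDist.self v), sum_waveCoeff_mul _ _ _ le_rfl (by omega)]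
    simp [waveCoeff]
    ring
  · intro w hw
    obtain ⟨k, hk, h⟩ := exists_atDist_of_wave_ne_zero (left_ne_zero_of_mul hw)
    exact ⟨k, by omega, h⟩
  · intro i d hd w hw
    rw [wave_apply (mem_branch.1 hw).1]

lemma inner_wave_neighbor (hv : TreeLikeVtx H 3 R v) (hR : s + 2 ≤ R)
    (hinj : Function.Injective u) (hu : ∀ w, H.Adj v w ↔ ∃ i, u i = w) (j : Fin 3) :
    ⟪wave H (s + 1) v, wave H (s + 1) (u j)⟫ = -√2 * (s + 1) := by
  have hs : (√2)⁻¹ * 2 = √2 := by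
    rw [inv_mul_eq_div, div_eq_iff (by positivity)]; simp
  have hp : (-(√2)⁻¹ : ℝ) ^ 3 = -(√2)⁻¹ * 2⁻¹ := by
    rw [pow_succ, show (-(√2)⁻¹ : ℝ) ^ 2 = 2⁻¹ by simp]; ring
  have hadj : ∀ i, H.Adj v (u i) := fun i => (hu _).2 ⟨i, rfl⟩
  have h01 := sum_waveCoeff_mul s 0 1 (by omega) (by omega)
  have h12 := sum_waveCoeff_mul s 1 2 (by omega) (by omega)
  rw [inner_eq_sum, hv.sum_eq hinj hu (m := s + 2) hR (φ := fun i d => waveCoeff (s + 1) (d + 1) *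
    waveCoeff (s + 1) (if i = j then d else d + 2))]
  · rw [wave_apply (AtDist.self v), wave_apply (AtDist.of_adj (hadj j)).symm]
    simp only [Nat.add_zero, mul_comm (waveCoeff (s + 1) _) (waveCoeff (s + 1) (_ + 1)),
      zero_add] at h01
    have : ∀ i, ∑ d ∈ Finset.range (s + 2), 2 ^ d * (waveCoeff (s + 1) (d + 1) *
        waveCoeff (s + 1) (if i = j then d else d + 2)) =
        if i = j then -((s + 1) * (√2)⁻¹) else -(s * (√2)⁻¹ * 2⁻¹) := by
      intro i
      split_ifs with h
      · rw [h01]; push_cast; ring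
      · rw [h12, show 1 + 2 = 3 from rfl, hp]; push_cast; ring
    simp only [this]
    rw [Fin.sum_univ_three]
    rw [← hs]
    fin_cases j <;> simp [waveCoeff] <;> linear_combination ((s : ℝ) + 1 / 2) * hs
  · intro w hw
    obtain ⟨k, hk, h⟩ := exists_atDist_of_wave_ne_zero (left_ne_zero_of_mul hw)
    exact ⟨k, by omega, h⟩
  · intro i d hd w hw
    rw [wave_apply (mem_branch.1 hw).1, hv.wave_neighbor_apply hu hinj i j (by omega) hw]

lemma inner_wave_neighbors (hv : TreeLikeVtx H 3 R v) (hR : s + 2 ≤ R)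
    (hinj : Function.Injective u) (hu : ∀ w, H.Adj v w ↔ ∃ i, u i = w) (j k : Fin 3) :
    ⟪wave H (s + 1) (u j), wave H (s + 1) (u k)⟫ =
      if j = k then 1 + 3 * ((s : ℝ) + 1) / 2 else (5 * (s : ℝ) + 2) / 4 := by
  have hp : (-(√2)⁻¹ : ℝ) ^ 2 = 2⁻¹ := by simp
  have hp4 : (-(√2)⁻¹ : ℝ) ^ 4 = 4⁻¹ := by
    rw [show 4 = 2 * 2 from rfl, pow_mul, hp]; norm_num
  have hadj : ∀ i, H.Adj v (u i) := fun i => (hu _).2 ⟨i, rfl⟩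
  have h00 := sum_waveCoeff_mul s 0 0 (by omega) (by omega)
  have h02 := sum_waveCoeff_mul s 0 2 (by omega) (by omega)
  have h22 := sum_waveCoeff_mul s 2 2 (by omega) (by omega)
  rw [inner_eq_sum, hv.sum_eq hinj hu (m := s + 2) hR (φ := fun i d =>
    waveCoeff (s + 1) (if i = j then d else d + 2) *
    waveCoeff (s + 1) (if i = k then d else d + 2))]
  · rw [wave_apply (AtDist.of_adj (hadj j)).symm, wave_apply (AtDist.of_adj (hadj k)).symm]
    simp only [Nat.add_zero, zero_add] at h00 h02
    have h20 := h02
    simp only [mul_comm (waveCoeff (s + 1) _) (waveCoeff (s + 1) (_ + 2))] at h20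
    have : ∀ i, ∑ d ∈ Finset.range (s + 2), 2 ^ d *
        (waveCoeff (s + 1) (if i = j then d else d + 2) *
          waveCoeff (s + 1) (if i = k then d else d + 2)) =
        if i = j then (if i = k then (s + 2 : ℝ) else s / 2) else
          if i = k then (s / 2 : ℝ) else s / 4 := by
      intro i
      split_ifs with h1 h2 h2
      · rw [h00]; push_cast; ring
      · rw [h02, hp]; push_cast; ring
      · rw [h20, hp]; push_cast; ring
      · rw [h22, hp4]; push_cast; ring
    simp only [this]
    have hsum : ∀ A B C : ℝ, ∑ i, (if i = j then (if i = k then A else B) else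
        if i = k then B else C) = if j = k then A + 2 * C else 2 * B + C := by
      intro A B C
      revert j k
      simp [Fin.forall_fin_succ, Fin.sum_univ_three]
      constructor <;> ring_nf <;> simp
    rw [hsum]
    have h1 : waveCoeff (s + 1) 1 * waveCoeff (s + 1) 1 = 2⁻¹ := by
      simp [waveCoeff, ← sq]
    rw [h1]
    split_ifs <;> ring
  · intro w hw
    obtain ⟨l, hl, h⟩ := exists_atDist_of_wave_ne_zero (left_ne_zero_of_mul hw)
    obtain ⟨m, hm, hm1, hm2⟩ := h.symm.step (hadj j).symm
    exact ⟨m, by omega, hm.symm⟩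
  · intro i d hd w hw
    rw [hv.wave_neighbor_apply hu hinj i j (by omega) hw,
      hv.wave_neighbor_apply hu hinj i k (by omega) hw]

end TreeLikeVtx

end Wave

section Cut

variable {V : Type*} {H : SimpleGraph V}

lemma bisectionSize_compl (S : Set V) : bisectionSize H Sᶜ = bisectionSize H S := by
  unfold bisectionSize
  congr 1
  ext e
  constructor
  · rintro ⟨he, u, v, rfl, hu, hv⟩
    exact ⟨he, v, u, Sym2.eq_swap, by simpa using hv, hu⟩
  · rintro ⟨he, u, v, rfl, hu, hv⟩
    exact ⟨he, v, u, Sym2.eq_swap, hv, by simpa using hu⟩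

variable [Fintype V]

lemma bisectionSize_le_sdiff_singleton (S : Set V) (x : V) :
    bisectionSize H S ≤ bisectionSize H (S \ {x}) + (H.neighborSet x).ncard := by
  classical
  unfold bisectionSize
  have hx : (H.neighborSet x).ncard = ((fun y => s(x, y)) '' H.neighborSet x).ncard :=
    (Set.ncard_image_of_injective _ fun a b h => Sym2.congr_right.1 h).symm
  rw [hx]
  refine le_trans (Set.ncard_le_ncard ?_ (Set.toFinite _)) (Set.ncard_union_le _ _)
  rintro e ⟨he, u, v, rfl, hu, hv⟩
  by_cases h : u = x
  · subst h
    exact Or.inr ⟨v, he, rfl⟩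
  · exact Or.inl ⟨he, u, v, rfl, ⟨hu, h⟩, fun h' => hv h'.1⟩

lemma exists_bisection_of_imbalance_le {D : Set V} {d : ℕ}
    (hd : ∀ x ∈ D, (H.neighborSet x).ncard ≤ d) (hD : 2 * Dᶜ.ncard ≤ Fintype.card V) (m : ℕ) :
    ∀ S : Set V, S.ncard ≤ Sᶜ.ncard + (2 * m + 1) → Sᶜ.ncard ≤ S.ncard + (2 * m + 1) →
      ∃ S' : Set V, IsBisection S' ∧ bisectionSize H S ≤ bisectionSize H S' + d * m := by
  induction m with
  | zero => exact fun S h1 h2 => ⟨S, ⟨h1, h2⟩, le_rfl⟩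
  | succ m ih =>
    have key : ∀ S : Set V, Sᶜ.ncard + (2 * m + 2) ≤ S.ncard →
        S.ncard ≤ Sᶜ.ncard + (2 * (m + 1) + 1) →
        ∃ S' : Set V, IsBisection S' ∧
          bisectionSize H S ≤ bisectionSize H S' + d * (m + 1) := by
      intro S h1 h2
      have hS := Set.ncard_add_ncard_compl S
      rw [Nat.card_eq_fintype_card] at hS
      obtain ⟨x, hxS, hxD⟩ : ∃ x ∈ S, x ∈ D := by
        by_contra! hcon
        have : S.ncard ≤ Dᶜ.ncard := Set.ncard_le_ncard hcon (Set.toFinite _)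
        omega
      have h3 := Set.ncard_sdiff_singleton_add_one hxS
      have h4 := Set.ncard_add_ncard_compl (S \ {x})
      rw [Nat.card_eq_fintype_card] at h4
      obtain ⟨S', hS', hle⟩ := ih (S \ {x}) (by omega) (by omega)
      refine ⟨S', hS', ?_⟩
      have h5 := bisectionSize_le_sdiff_singleton (H := H) S x
      have h6 := hd x hxD
      rw [mul_add, mul_one]
      omega
    intro S h1 h2
    rcases le_or_gt (Sᶜ.ncard + (2 * m + 2)) S.ncard with h3 | h3
    · exact key S h3 h1
    rcases le_or_gt (S.ncard + (2 * m + 2)) Sᶜ.ncard with h4 | h4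
    · obtain ⟨S', hS', hle⟩ := key Sᶜ (by rwa [compl_compl]) (by rwa [compl_compl])
      rw [bisectionSize_compl] at hle
      exact ⟨S', hS', hle⟩
    · obtain ⟨S', hS', hle⟩ := ih S (by omega) (by omega)
      refine ⟨S', hS', hle.trans ?_⟩
      gcongr
      omega

open Classical in
lemma bisectionSize_eq_sum (S : Set V) : (bisectionSize H S : ℝ) =
    ∑ u, ∑ v, if H.Adj u v then (if u ∈ S ∧ v ∉ S then (1 : ℝ) else 0) else 0 := by
  have h : bisectionSize H S =
      ((Finset.univ : Finset (V × V)).filter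
        fun q => H.Adj q.1 q.2 ∧ q.1 ∈ S ∧ q.2 ∉ S).card := by
    have himg : {e ∈ H.edgeSet | ∃ u v : V, e = s(u, v) ∧ u ∈ S ∧ v ∉ S} =
        (fun q : V × V => s(q.1, q.2)) '' {q | H.Adj q.1 q.2 ∧ q.1 ∈ S ∧ q.2 ∉ S} := by
      ext e
      constructor
      · rintro ⟨he, u, v, rfl, hu, hv⟩
        exact ⟨(u, v), ⟨he, hu, hv⟩, rfl⟩
      · rintro ⟨⟨u, v⟩, ⟨he, hu, hv⟩, rfl⟩
        exact ⟨he, u, v, rfl, hu, hv⟩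
    rw [bisectionSize, himg, Set.InjOn.ncard_image, Set.ncard_eq_toFinset_card']
    · congr 1
      ext; simp
    · rintro ⟨a, b⟩ ⟨-, ha, hb⟩ ⟨a', b'⟩ ⟨-, ha', hb'⟩ hab
      rcases Sym2.eq_iff.1 hab with ⟨h1, h2⟩ | ⟨h1, h2⟩
      · exact Prod.ext h1 h2
      · exact absurd (h1 ▸ ha) hb'
  rw [h, ← Finset.sum_boole, Fintype.sum_prod_type]
  refine Finset.sum_congr rfl fun u _ => Finset.sum_congr rfl fun v _ => ?_
  split_ifs <;> simp_all

open Classical in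
/-- The size of a cut as a quadratic form in its sign vector. -/
lemma four_mul_bisectionSize {x : V → ℝ} (hx : ∀ v, x v = 1 ∨ x v = -1) :
    4 * (bisectionSize H {v | x v = 1} : ℝ) =
      ∑ u, ∑ v, if H.Adj u v then 1 - x u * x v else 0 := by
  have hanti : ∑ u, ∑ v, (if H.Adj u v then x u - x v else 0) = 0 := by
    have : ∑ u, ∑ v, (if H.Adj u v then x u - x v else 0) =
        -∑ u, ∑ v, (if H.Adj u v then x u - x v else 0) := by
      conv_lhs => rw [Finset.sum_comm]
      rw [← Finset.sum_neg_distrib]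
      refine Finset.sum_congr rfl fun u _ => ?_
      rw [← Finset.sum_neg_distrib]
      refine Finset.sum_congr rfl fun v _ => ?_
      simp only [H.adj_comm v u]
      split_ifs <;> ring
    linarith
  rw [bisectionSize_eq_sum]
  refine Eq.trans ?_ ((congrArg (_ + ·) hanti).trans (add_zero _))
  rw [Finset.mul_sum, ← Finset.sum_add_distrib]
  refine Finset.sum_congr rfl fun u _ => ?_
  rw [Finset.mul_sum, ← Finset.sum_add_distrib]
  refine Finset.sum_congr rfl fun v _ => ?_
  by_cases h : H.Adj u v
  · rcases hx u with hu | hu <;> rcases hx v with hv | hv <;>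
      simp only [Set.mem_ofPred_eq, h, hu, hv] <;> norm_num
  · simp [h]

lemma exists_independent_subset {D : Finset V} (hD : ∀ x ∈ D, (H.neighborSet x).ncard ≤ 3) :
    ∃ I ⊆ D, (∀ x ∈ I, ∀ y ∈ I, ¬ H.Adj x y) ∧ D.card ≤ 4 * I.card := by
  classical
  obtain ⟨I, hI⟩ := (D.powerset.filter fun I => ∀ x ∈ I, ∀ y ∈ I, ¬ H.Adj x y).exists_maximal
    ⟨∅, by simp⟩
  have hmem := hI.prop
  simp only [Finset.mem_filter, Finset.mem_powerset] at hmem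
  refine ⟨I, hmem.1, hmem.2, ?_⟩
  have hsub : D ⊆ I.biUnion fun x => insert x (H.neighborSet x).toFinset := by
    intro y hy
    by_contra hcon
    simp only [Finset.mem_biUnion, Finset.mem_insert, Set.mem_toFinset,
      SimpleGraph.mem_neighborSet, not_exists, not_and, not_or] at hcon
    have hyI : y ∉ I := fun h => (hcon y h).1 rfl
    refine hyI (hI.le_of_ge (y := insert y I) ?_ (Finset.subset_insert _ _)
      (Finset.mem_insert_self _ _))
    simp only [Finset.mem_filter, Finset.mem_powerset, Finset.insert_subset_iff,
      Finset.mem_insert, forall_eq_or_imp]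
    exact ⟨⟨hy, hmem.1⟩, ⟨H.irrefl, fun x hx h => (hcon x hx).2 h.symm⟩,
      fun x hx => ⟨(hcon x hx).2, hmem.2 x hx⟩⟩
  refine (Finset.card_le_card hsub).trans (Finset.card_biUnion_le.trans ?_)
  rw [mul_comm, ← smul_eq_mul]
  refine Finset.sum_le_card_nsmul _ _ _ fun x hx => ?_
  have := hD x (hmem.1 hx)
  rw [Set.ncard_eq_toFinset_card'] at this
  exact (Finset.card_insert_le _ _).trans (by omega)

end Cut

section Majority

variable {V : Type*} [Fintype V] {H : SimpleGraph V}

open Classical in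
/-- The sum of `x` over the neighbours of `v`. -/
noncomputable def nbrSum (H : SimpleGraph V) (x : V → ℝ) (v : V) : ℝ :=
  ∑ w, if H.Adj v w then x w else 0

lemma nbrSum_eq {ι : Type*} [Fintype ι] {v : V} {u : ι → V} (hinj : Function.Injective u)
    (hu : ∀ w, H.Adj v w ↔ ∃ i, u i = w) (x : V → ℝ) : nbrSum H x v = ∑ i, x (u i) := by
  classical
  rw [nbrSum, ← Finset.sum_filter, ← Finset.sum_image (s := Finset.univ) (g := u) (f := x)
    (fun i _ j _ h => hinj h)]
  congr 1
  ext w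
  simp [hu]

open Classical in
/-- Replace the sign of each vertex of `I` by the one opposite to the majority of its
neighbours. -/
noncomputable def antiMajority (H : SimpleGraph V) (I : Finset V) (x : V → ℝ) (v : V) : ℝ :=
  if v ∈ I then -Real.sign (nbrSum H x v) else x v

lemma sign_sum_three {x : Fin 3 → ℝ} (hx : ∀ i, x i = 1 ∨ x i = -1) :
    (Real.sign (∑ i, x i) = 1 ∨ Real.sign (∑ i, x i) = -1) ∧
      Real.sign (∑ i, x i) * ∑ i, x i = (3 + (∑ i, x i) ^ 2) / 4 := by
  rw [Fin.sum_univ_three]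
  rcases hx 0 with h0 | h0 <;> rcases hx 1 with h1 | h1 <;> rcases hx 2 with h2 | h2 <;>
    rw [h0, h1, h2] <;> norm_num [Real.sign]

lemma antiMajority_eq_one_or {D I : Finset V} {x : V → ℝ}
    (hD : ∀ v ∈ D, ∃ u : Fin 3 → V, Function.Injective u ∧ ∀ w, H.Adj v w ↔ ∃ i, u i = w)
    (hID : I ⊆ D) (hx : ∀ v, x v = 1 ∨ x v = -1) (v : V) :
    antiMajority H I x v = 1 ∨ antiMajority H I x v = -1 := by
  unfold antiMajority
  split_ifs with h
  · obtain ⟨u, hinj, hu⟩ := hD v (hID h)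
    rw [nbrSum_eq hinj hu]
    rcases (sign_sum_three fun i => hx (u i)).1 with h | h <;> simp [h]
  · exact hx v

open Classical in
lemma le_four_mul_bisectionSize_antiMajority {D I : Finset V} {x : V → ℝ}
    (hD : ∀ v ∈ D, ∃ u : Fin 3 → V, Function.Injective u ∧ ∀ w, H.Adj v w ↔ ∃ i, u i = w)
    (hID : I ⊆ D) (hx : ∀ v, x v = 1 ∨ x v = -1)
    (hI : ∀ x ∈ I, ∀ y ∈ I, ¬ H.Adj x y) :
    ∑ v ∈ D, nbrSum H (fun w => 1 - x v * x w) v +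
        2 * ∑ v ∈ I, ((3 + nbrSum H x v ^ 2) / 4 + x v * nbrSum H x v) ≤
      4 * (bisectionSize H {v | antiMajority H I x v = 1} : ℝ) := by
  rw [four_mul_bisectionSize (antiMajority_eq_one_or hD hID hx)]
  set y := antiMajority H I x with hy
  have h0 : ∀ v, v ∉ I → y v - x v = 0 := fun v hv => by simp [hy, antiMajority, hv]
  have h1 : ∀ v ∈ I, (y v - x v) * nbrSum H x v =
      -((3 + nbrSum H x v ^ 2) / 4 + x v * nbrSum H x v) := by
    intro v hv
    obtain ⟨u, hinj, hu⟩ := hD v (hID hv)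
    simp only [hy, antiMajority, if_pos hv]
    rw [nbrSum_eq hinj hu, ← (sign_sum_three fun i => hx (u i)).2]
    ring
  have h2 : ∑ v, (y v - x v) * nbrSum H x v =
      -∑ v ∈ I, ((3 + nbrSum H x v ^ 2) / 4 + x v * nbrSum H x v) := by
    rw [← Finset.sum_neg_distrib, ← Finset.sum_congr rfl h1]
    refine (Finset.sum_subset (Finset.subset_univ _) fun v _ hv => ?_).symm
    rw [h0 v hv, zero_mul]
  have h3 : ∑ u, ∑ v, (if H.Adj u v then 1 - y u * y v else 0) =
      ∑ v, nbrSum H (fun w => 1 - x v * x w) v - 2 * ∑ v, (y v - x v) * nbrSum H x v := by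
    have h4 : ∑ v, (y v - x v) * nbrSum H x v =
        ∑ u, ∑ v, if H.Adj u v then (y u - x u) * x v else 0 := by
      refine Finset.sum_congr rfl fun u _ => ?_
      rw [nbrSum, Finset.mul_sum]
      refine Finset.sum_congr rfl fun v _ => ?_
      split_ifs <;> simp
    have h5 : ∑ v, (y v - x v) * nbrSum H x v =
        ∑ u, ∑ v, if H.Adj u v then (y v - x v) * x u else 0 := by
      rw [h4, Finset.sum_comm]
      simp only [H.adj_comm]
    rw [(two_mul _).trans (congrArg₂ (· + ·) h4 h5)]
    unfold nbrSum
    rw [← Finset.sum_add_distrib, ← Finset.sum_sub_distrib]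
    refine Finset.sum_congr rfl fun u _ => ?_
    rw [← Finset.sum_add_distrib, ← Finset.sum_sub_distrib]
    refine Finset.sum_congr rfl fun v _ => ?_
    split_ifs with hadj
    · have : (y u - x u) * (y v - x v) = 0 := by
        by_cases hu : u ∈ I
        · rw [h0 v fun hv => hI u hu v hv hadj, mul_zero]
        · rw [h0 u hu, zero_mul]
      linear_combination -this
    · simp
  rw [h3, h2, mul_neg, sub_neg_eq_add]
  refine add_le_add_left (Finset.sum_le_sum_of_subset_of_nonneg (Finset.subset_univ _) ?_) _
  intro v _ _
  refine Finset.sum_nonneg fun w _ => ?_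
  split_ifs
  · rcases hx v with h | h <;> rcases hx w with h' | h' <;> simp only [h, h'] <;> norm_num
  · rfl

end Majority

section Rounding

open MeasureTheory ProbabilityTheory RealInnerProductSpace

variable {V : Type*} [Fintype V] {H : SimpleGraph V}

/-- The signs of a random Gaussian vector along the wave vectors. -/
noncomputable def waveSign (H : SimpleGraph V) (r : ℕ) (g : EuclideanSpace ℝ V) (v : V) : ℝ :=
  Real.sign ⟪wave H r v, g⟫

lemma abs_sign_le_one (x : ℝ) : |Real.sign x| ≤ 1 := by
  rcases Real.sign_apply_eq x with h | h | h <;> simp [h]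

@[fun_prop]
lemma measurable_waveSign (r : ℕ) (v : V) : Measurable fun g => waveSign H r g v :=
  measurable_realSign.comp (by fun_prop)

lemma integrable_of_forall_abs_le {f : EuclideanSpace ℝ V → ℝ} (hf : Measurable f) {C : ℝ}
    (hC : ∀ g, |f g| ≤ C) : Integrable f (stdGaussian (EuclideanSpace ℝ V)) :=
  Integrable.of_bound hf.aestronglyMeasurable C (.of_forall hC)

lemma integrable_waveSign_mul (r : ℕ) (u v : V) :
    Integrable (fun g => waveSign H r g u * waveSign H r g v)
      (stdGaussian (EuclideanSpace ℝ V)) :=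
  integrable_of_forall_abs_le (by fun_prop) (C := 1) fun g => by
    rw [abs_mul]
    exact mul_le_one₀ (abs_sign_le_one _) (abs_nonneg _) (abs_sign_le_one _)

lemma integral_waveSign_mul (r : ℕ) (u v : V) :
    ∫ g, waveSign H r g u * waveSign H r g v ∂(stdGaussian (EuclideanSpace ℝ V)) =
      1 - 2 * InnerProductGeometry.angle (wave H r u) (wave H r v) / π :=
  integral_sign_inner_mul_sign_inner (wave_ne_zero H r u) (wave_ne_zero H r v)

lemma norm_mul_norm_of_inner_self_eq {E : Type*} [NormedAddCommGroup E] [InnerProductSpace ℝ E]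
    {x y : E} {a : ℝ} (hx : ⟪x, x⟫ = a) (hy : ⟪y, y⟫ = a) : ‖x‖ * ‖y‖ = a := by
  have h : ‖x‖ = ‖y‖ := by
    rw [norm_eq_sqrt_real_inner, norm_eq_sqrt_real_inner, hx, hy]
  rw [← h, ← hx, real_inner_self_eq_norm_mul_norm]

/-- The correlation between the signs of adjacent vertices. -/
noncomputable def edgeCorr (s : ℕ) : ℝ :=
  1 - 2 * arccos (-√2 * (s + 1) / (1 + 3 * (s + 1) / 2)) / π

/-- The correlation between the signs of vertices at distance two. -/
noncomputable def pairCorr (s : ℕ) : ℝ :=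
  1 - 2 * arccos ((5 * s + 2) / 4 / (1 + 3 * (s + 1) / 2)) / π

namespace TreeLikeVtx

variable {s R : ℕ} {v : V} {u : Fin 3 → V}

lemma integral_waveSign_neighbor (hv : TreeLikeVtx H 3 R v) (hR : s + 2 ≤ R)
    (hinj : Function.Injective u) (hu : ∀ w, H.Adj v w ↔ ∃ i, u i = w) (j : Fin 3) :
    ∫ g, waveSign H (s + 1) g v * waveSign H (s + 1) g (u j)
      ∂(stdGaussian (EuclideanSpace ℝ V)) = edgeCorr s := by
  rw [integral_waveSign_mul, InnerProductGeometry.angle, edgeCorr,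
    hv.inner_wave_neighbor hR hinj hu, norm_mul_norm_of_inner_self_eq (hv.inner_wave_self hR)
    ((hv.inner_wave_neighbors hR hinj hu j j).trans (if_pos rfl))]

lemma integral_waveSign_neighbors (hv : TreeLikeVtx H 3 R v) (hR : s + 2 ≤ R)
    (hinj : Function.Injective u) (hu : ∀ w, H.Adj v w ↔ ∃ i, u i = w) (j k : Fin 3) :
    ∫ g, waveSign H (s + 1) g (u j) * waveSign H (s + 1) g (u k)
      ∂(stdGaussian (EuclideanSpace ℝ V)) = if j = k then 1 else pairCorr s := by
  rw [integral_waveSign_mul]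
  split_ifs with h
  · rw [h, InnerProductGeometry.angle_self (wave_ne_zero _ _ _)]
    simp
  · rw [InnerProductGeometry.angle, pairCorr,
      (hv.inner_wave_neighbors hR hinj hu j k).trans (if_neg h), norm_mul_norm_of_inner_self_eq
      ((hv.inner_wave_neighbors hR hinj hu j j).trans (if_pos rfl))
      ((hv.inner_wave_neighbors hR hinj hu k k).trans (if_pos rfl))]

lemma integral_nbrSum_one_sub (hv : TreeLikeVtx H 3 R v) (hR : s + 2 ≤ R) :
    Integrable (fun g => nbrSum H (fun w => 1 - waveSign H (s + 1) g v * waveSign H (s + 1) g w) v)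
        (stdGaussian (EuclideanSpace ℝ V)) ∧
      ∫ g, nbrSum H (fun w => 1 - waveSign H (s + 1) g v * waveSign H (s + 1) g w) v
        ∂(stdGaussian (EuclideanSpace ℝ V)) = 3 * (1 - edgeCorr s) := by
  obtain ⟨u, hinj, hu⟩ := hv.exists_neighbors (by omega)
  simp only [nbrSum_eq hinj hu]
  have hInt : ∀ i, Integrable
      (fun g => 1 - waveSign H (s + 1) g v * waveSign H (s + 1) g (u i))
      (stdGaussian (EuclideanSpace ℝ V)) :=
    fun i => (integrable_const 1).sub (integrable_waveSign_mul _ _ _)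
  refine ⟨integrable_finsetSum _ fun i _ => hInt i, ?_⟩
  rw [integral_finsetSum _ fun i _ => hInt i, Finset.sum_congr rfl fun i _ =>
    (integral_sub (integrable_const 1) (integrable_waveSign_mul _ _ _)).trans
      (congrArg _ (hv.integral_waveSign_neighbor hR hinj hu i))]
  simp
  ring

lemma integral_nbrSum_sq (hv : TreeLikeVtx H 3 R v) (hR : s + 2 ≤ R) :
    Integrable (fun g => (3 + nbrSum H (waveSign H (s + 1) g) v ^ 2) / 4 +
        waveSign H (s + 1) g v * nbrSum H (waveSign H (s + 1) g) v)
        (stdGaussian (EuclideanSpace ℝ V)) ∧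
      ∫ g, ((3 + nbrSum H (waveSign H (s + 1) g) v ^ 2) / 4 +
        waveSign H (s + 1) g v * nbrSum H (waveSign H (s + 1) g) v)
        ∂(stdGaussian (EuclideanSpace ℝ V)) =
        (6 + 6 * pairCorr s) / 4 + 3 * edgeCorr s := by
  obtain ⟨u, hinj, hu⟩ := hv.exists_neighbors (by omega)
  simp only [nbrSum_eq hinj hu, sq, Finset.sum_mul_sum]
  simp only [Finset.mul_sum _ _ (waveSign _ _ _ v)]
  have h1 : Integrable (fun g => ∑ i, ∑ j, waveSign H (s + 1) g (u i) * waveSign H (s + 1) g (u j))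
      (stdGaussian (EuclideanSpace ℝ V)) :=
    integrable_finsetSum _ fun i _ => integrable_finsetSum _ fun j _ =>
      integrable_waveSign_mul _ _ _
  have h2 : Integrable (fun g => (3 + ∑ i, ∑ j,
      waveSign H (s + 1) g (u i) * waveSign H (s + 1) g (u j)) / 4)
      (stdGaussian (EuclideanSpace ℝ V)) := ((integrable_const 3).add h1).div_const 4
  have h3 : Integrable (fun g => ∑ i, waveSign H (s + 1) g v * waveSign H (s + 1) g (u i))
      (stdGaussian (EuclideanSpace ℝ V)) :=
    integrable_finsetSum _ fun i _ => integrable_waveSign_mul _ _ _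
  refine ⟨h2.add h3, ?_⟩
  rw [integral_add h2 h3, integral_div, integral_add (integrable_const 3) h1,
    integral_finsetSum _ fun i _ => integrable_finsetSum _ fun j _ =>
      integrable_waveSign_mul _ _ _,
    integral_finsetSum _ fun i _ => integrable_waveSign_mul _ _ _]
  simp_rw [integral_finsetSum _ fun i _ => integrable_waveSign_mul _ _ _,
    hv.integral_waveSign_neighbor hR hinj hu, hv.integral_waveSign_neighbors hR hinj hu]
  simp [Fin.sum_univ_three]
  ring

end TreeLikeVtx

section Flip

open Classical in
/-- Change the sign of the coordinates in `P`. -/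
noncomputable def flipOn (P : Set V) : EuclideanSpace ℝ V ≃ₗᵢ[ℝ] EuclideanSpace ℝ V :=
  LinearIsometryEquiv.piLpCongrRight 2 fun w =>
    if w ∈ P then LinearIsometryEquiv.neg ℝ else LinearIsometryEquiv.refl ℝ ℝ

lemma inner_flipOn_of_subset {P : Set V} {x : EuclideanSpace ℝ V} (hx : ∀ w, x w ≠ 0 → w ∈ P)
    (g : EuclideanSpace ℝ V) : ⟪x, flipOn P g⟫ = -⟪x, g⟫ := by
  rw [inner_eq_sum, inner_eq_sum, ← Finset.sum_neg_distrib]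
  refine Finset.sum_congr rfl fun w _ => ?_
  by_cases h : x w = 0
  · simp [h]
  · simp [flipOn, hx w h]

lemma inner_flipOn_of_disjoint {P : Set V} {x : EuclideanSpace ℝ V} (hx : ∀ w, x w ≠ 0 → w ∉ P)
    (g : EuclideanSpace ℝ V) : ⟪x, flipOn P g⟫ = ⟪x, g⟫ := by
  rw [inner_eq_sum, inner_eq_sum]
  refine Finset.sum_congr rfl fun w _ => ?_
  by_cases h : x w = 0
  · simp [h]
  · simp [flipOn, hx w h]

lemma integral_eq_zero_of_flipOn {P : Set V} {f : EuclideanSpace ℝ V → ℝ}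
    (hf : ∀ g, f (flipOn P g) = -f g) : ∫ g, f g ∂(stdGaussian (EuclideanSpace ℝ V)) = 0 := by
  have h : ∫ g, f (flipOn P g) ∂(stdGaussian (EuclideanSpace ℝ V)) =
      ∫ g, f g ∂(stdGaussian (EuclideanSpace ℝ V)) := by
    conv_rhs => rw [← stdGaussian_map (flipOn P)]
    exact ((flipOn P).toHomeomorph.measurableEmbedding.integral_map f).symm
  simp only [hf, integral_neg] at h
  linarith

end Flip

/-- The rounded signs after the local improvement. -/
noncomputable def improvedSign (H : SimpleGraph V) (r : ℕ) (I : Finset V)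
    (g : EuclideanSpace ℝ V) : V → ℝ := antiMajority H I (waveSign H r g)

lemma antiMajority_neg_of_forall {I : Finset V} {x y : V → ℝ} {v : V} (h0 : x v = -y v)
    (h : ∀ w, H.Adj v w → x w = -y w) : antiMajority H I x v = -antiMajority H I y v := by
  classical
  have : nbrSum H x v = -nbrSum H y v := by
    rw [nbrSum, nbrSum, ← Finset.sum_neg_distrib]
    refine Finset.sum_congr rfl fun w _ => ?_
    split_ifs with hw
    · exact h w hw
    · simp
  unfold antiMajority
  split_ifs
  · rw [this, Real.sign_neg]
  · exact h0

lemma antiMajority_congr {I : Finset V} {x y : V → ℝ} {v : V} (h0 : x v = y v)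
    (h : ∀ w, H.Adj v w → x w = y w) : antiMajority H I x v = antiMajority H I y v := by
  rw [antiMajority_neg_of_forall (y := -y) (by simpa using h0) (by simpa using h),
    ← antiMajority_neg_of_forall (x := y) (y := -y) (by simp) (by simp)]

lemma integral_improvedSign_mul_eq_zero {r : ℕ} {I : Finset V} {u v : V}
    (huv : ∀ k ≤ 2 * r + 2, ¬ AtDist H k u v) :
    ∫ g, improvedSign H r I g u * improvedSign H r I g v
      ∂(stdGaussian (EuclideanSpace ℝ V)) = 0 := by
  set P : Set V := {w | ∃ k ≤ r + 1, AtDist H k u w}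
  have hsupp : ∀ {x y z : V}, (y = x ∨ H.Adj x y) → wave H r y z ≠ 0 →
      ∃ k ≤ r + 1, AtDist H k x z := by
    intro x y z hxy hz
    obtain ⟨k, hk, h⟩ := exists_atDist_of_wave_ne_zero hz
    rcases hxy with rfl | hxy
    · exact ⟨k, by omega, h⟩
    · obtain ⟨l, hl, hl', -⟩ := h.symm.step hxy.symm
      exact ⟨l, by omega, hl.symm⟩
  have hdisj : ∀ {z : V}, (∃ k ≤ r + 1, AtDist H k v z) → z ∉ P := by
    rintro z ⟨k, hk, h⟩ ⟨l, hl, h'⟩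
    obtain ⟨m, hm, h''⟩ := h'.triangle h
    exact huv m (by omega) h''
  have hneg : ∀ g y, (y = u ∨ H.Adj u y) →
      waveSign H r (flipOn P g) y = -waveSign H r g y := by
    intro g y hy
    have hsub : ∀ z, wave H r y z ≠ 0 → z ∈ P := fun z hz => hsupp hy hz
    rw [waveSign, waveSign, inner_flipOn_of_subset hsub, Real.sign_neg]
  have hpos : ∀ g y, (y = v ∨ H.Adj v y) →
      waveSign H r (flipOn P g) y = waveSign H r g y := by
    intro g y hy
    rw [waveSign, waveSign, inner_flipOn_of_disjoint fun z hz => hdisj (hsupp hy hz)]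
  refine integral_eq_zero_of_flipOn (P := P) fun g => ?_
  rw [improvedSign, improvedSign, antiMajority_neg_of_forall (hneg g u (.inl rfl))
    fun w hw => hneg g w (.inr hw), antiMajority_congr (hpos g v (.inl rfl))
    fun w hw => hpos g w (.inr hw), neg_mul]

@[fun_prop]
lemma measurable_improvedSign (r : ℕ) (I : Finset V) (v : V) :
    Measurable fun g => improvedSign H r I g v := by
  classical
  unfold improvedSign antiMajority
  split_ifs
  · refine (measurable_realSign.comp ?_).neg
    unfold nbrSum
    refine Finset.measurable_sum _ fun w _ => ?_
    split_ifs <;> fun_prop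
  · fun_prop

lemma abs_improvedSign_le_one (r : ℕ) (I : Finset V) (g : EuclideanSpace ℝ V) (v : V) :
    |improvedSign H r I g v| ≤ 1 := by
  unfold improvedSign antiMajority
  split_ifs
  · rw [abs_neg]
    exact abs_sign_le_one _
  · exact abs_sign_le_one _

lemma abs_improvedSign_mul_le_one (r : ℕ) (I : Finset V) (g : EuclideanSpace ℝ V) (u v : V) :
    |improvedSign H r I g u * improvedSign H r I g v| ≤ 1 := by
  rw [abs_mul]
  exact mul_le_one₀ (abs_improvedSign_le_one _ _ _ _) (abs_nonneg _)
    (abs_improvedSign_le_one _ _ _ _)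

/-- A second moment bound for the total improved sign, coming from the finite range of
dependence. -/
lemma integral_sum_improvedSign_sq_le {r R : ℕ} {D I : Finset V}
    (hD : ∀ v ∈ D, TreeLikeVtx H 3 R v) (hR : 2 * r + 2 ≤ R) :
    Integrable (fun g => (∑ v ∈ D, improvedSign H r I g v) ^ 2)
        (stdGaussian (EuclideanSpace ℝ V)) ∧
      ∫ g, (∑ v ∈ D, improvedSign H r I g v) ^ 2 ∂(stdGaussian (EuclideanSpace ℝ V)) ≤
        D.card * (1 + 3 * ∑ d ∈ Finset.range (2 * r + 2), 2 ^ d : ℕ) := by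
  classical
  have hInt : ∀ u v, Integrable (fun g => improvedSign H r I g u * improvedSign H r I g v)
      (stdGaussian (EuclideanSpace ℝ V)) := fun u v =>
    integrable_of_forall_abs_le (by fun_prop) fun g => abs_improvedSign_mul_le_one r I g u v
  simp only [sq, Finset.sum_mul_sum]
  have hInt' := fun u : V => integrable_finsetSum D fun v _ => hInt u v
  refine ⟨integrable_finsetSum _ fun u _ => hInt' u, ?_⟩
  rw [integral_finsetSum _ fun u _ => hInt' u, ← nsmul_eq_mul]
  refine Finset.sum_le_card_nsmul _ _ _ fun u hu => ?_
  rw [integral_finsetSum _ fun v _ => hInt u v]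
  have hle : ∀ v ∈ D, ∫ g, improvedSign H r I g u * improvedSign H r I g v
      ∂(stdGaussian (EuclideanSpace ℝ V)) ≤
        if ∃ k ≤ 2 * r + 2, AtDist H k u v then 1 else 0 := by
    intro v _
    split_ifs with h
    · refine (integral_mono (hInt u v) (integrable_const (1 : ℝ)) fun g =>
        (abs_le.1 (abs_improvedSign_mul_le_one r I g u v)).2).trans ?_
      simp
    · push Not at h
      exact (integral_improvedSign_mul_eq_zero h).le
  refine (Finset.sum_le_sum hle).trans ?_
  rw [Finset.sum_boole, ← (hD u hu).card_ball hR (by omega), Set.ncard_eq_toFinset_card']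
  exact_mod_cast Finset.card_le_card fun v hv => by simpa using (Finset.mem_filter.1 hv).2

end Rounding

section FiniteBound

open MeasureTheory ProbabilityTheory RealInnerProductSpace

variable {V : Type*} [Fintype V] {H : SimpleGraph V}

lemma sum_eq_ncard_sub_ncard_compl {y : V → ℝ} (hy : ∀ v, y v = 1 ∨ y v = -1) :
    ∑ v, y v = ({v | y v = 1}.ncard : ℝ) - ({v | y v = 1}ᶜ.ncard : ℝ) := by
  classical
  have h : ∀ v, y v = (if y v = 1 then (1 : ℝ) else 0) - if ¬ y v = 1 then (1 : ℝ) else 0 := by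
    intro v
    rcases hy v with h | h <;> rw [h] <;> norm_num
  rw [Finset.sum_congr rfl fun v _ => h v, Finset.sum_sub_distrib, Finset.sum_boole,
    Finset.sum_boole, Set.ncard_eq_toFinset_card', Set.ncard_eq_toFinset_card']
  congr 3 <;> ext <;> simp

lemma exists_bisection_of_signs {D : Finset V} (hD : ∀ v ∈ D, (H.neighborSet v).ncard ≤ 3)
    (hcard : Fintype.card V ≤ 2 * D.card) {y : V → ℝ} (hy : ∀ v, y v = 1 ∨ y v = -1) :
    ∃ S : Set V, IsBisection S ∧ (bisectionSize H {v | y v = 1} : ℝ) -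
      3 / 2 * (|∑ v ∈ D, y v| + (Fintype.card V - D.card)) ≤ bisectionSize H S := by
  classical
  have hsum := sum_eq_ncard_sub_ncard_compl hy
  set S : Set V := {v | y v = 1}
  have hle : |(S.ncard : ℝ) - (Sᶜ.ncard : ℝ)| ≤
      |∑ v ∈ D, y v| + (Fintype.card V - D.card) := by
    rw [← hsum, ← Finset.sum_add_sum_compl D]
    refine (abs_add_le _ _).trans (add_le_add le_rfl ?_)
    refine (Finset.abs_sum_le_sum_abs _ _).trans ?_
    rw [Finset.sum_congr rfl fun v _ => show |y v| = 1 by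
      rcases hy v with h | h <;> simp [h], Finset.sum_const, Finset.card_compl,
      nsmul_eq_mul, mul_one, Nat.cast_sub (Finset.card_le_univ D)]
  have hDc : 2 * ((D : Set V)ᶜ).ncard ≤ Fintype.card V := by
    have h := Set.ncard_add_ncard_compl (D : Set V)
    rw [Nat.card_eq_fintype_card, Set.ncard_coe_finset] at h
    omega
  set J : ℕ := ((S.ncard : ℤ) - (Sᶜ.ncard : ℤ)).natAbs with hJ
  obtain ⟨S', hS', hsize⟩ := exists_bisection_of_imbalance_le (D := (D : Set V)) hD hDc (J / 2) S
    (by omega) (by omega)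
  refine ⟨S', hS', ?_⟩
  have h1 : (J : ℝ) = |(S.ncard : ℝ) - (Sᶜ.ncard : ℝ)| := by
    rw [hJ, Nat.cast_natAbs]
    push_cast
    rfl
  have h2 : ((J / 2 : ℕ) : ℝ) ≤ J / 2 := Nat.cast_div_le
  have h3 : (bisectionSize H S : ℝ) ≤ bisectionSize H S' + 3 * (J / 2 : ℕ) := by
    exact_mod_cast hsize
  linarith

/-- The constant gained by the local improvement. -/
noncomputable def majorityGain (s : ℕ) : ℝ := 1 + pairCorr s + 2 * edgeCorr s

lemma exists_bisection_ge {s : ℕ} {D : Finset V}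
    (hD : ∀ v ∈ D, TreeLikeVtx H 3 (2 * (s + 1) + 2) v) (hcard : Fintype.card V ≤ 2 * D.card)
    (hgain : 0 ≤ majorityGain s) {t : ℝ} (ht : 0 < t) :
    ∃ S : Set V, IsBisection S ∧
      D.card * (3 / 4 * (1 - edgeCorr s) + 3 / 16 * majorityGain s) -
        t * (D.card * (1 + 3 * ∑ d ∈ Finset.range (2 * (s + 1) + 2), 2 ^ d : ℕ)) -
        9 / (16 * t) - 3 / 2 * (Fintype.card V - D.card) ≤ bisectionSize H S := by
  classical
  have hdeg : ∀ v ∈ D, (H.neighborSet v).ncard ≤ 3 := fun v hv =>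
    ((hD v hv).2 v .rfl (by simp)).le
  have hnbr : ∀ v ∈ D, ∃ u : Fin 3 → V, Function.Injective u ∧ ∀ w, H.Adj v w ↔ ∃ i, u i = w :=
    fun v hv => (hD v hv).exists_neighbors (by omega)
  obtain ⟨I, hID, hI, hIcard⟩ := exists_independent_subset hdeg
  have h1 := fun v (hv : v ∈ D) => (hD v hv).integral_nbrSum_one_sub (s := s) (by omega)
  have h2 := fun v (hv : v ∈ I) => (hD v (hID hv)).integral_nbrSum_sq (s := s) (by omega)
  obtain ⟨h3, h4⟩ := integral_sum_improvedSign_sq_le (I := I) hD le_rfl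
  have hi1 := integrable_finsetSum D fun v hv => (h1 v hv).1
  have hi2 := (integrable_finsetSum I fun v hv => (h2 v hv).1).const_mul 2
  have hi12 := (hi1.add hi2).div_const 4
  have hi3 := h3.const_mul t
  have hnull : (stdGaussian (EuclideanSpace ℝ V)) (⋃ v, {g | ⟪wave H (s + 1) v, g⟫ = 0}) = 0 :=
    measure_iUnion_null fun v => stdGaussian_inner_eq_zero (wave_ne_zero H (s + 1) v)
  obtain ⟨g, hg, hle⟩ := exists_notMem_null_integral_le (hi12.sub hi3) hnull
  rw [integral_sub' hi12 hi3, integral_div, integral_add' hi1 hi2, integral_const_mul,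
    integral_const_mul, integral_finsetSum _ fun v hv => (h1 v hv).1,
    integral_finsetSum _ fun v hv => (h2 v hv).1, Finset.sum_congr rfl fun v hv => (h1 v hv).2,
    Finset.sum_congr rfl fun v hv => (h2 v hv).2, Finset.sum_const, Finset.sum_const] at hle
  simp only [Pi.sub_apply, Pi.add_apply, nsmul_eq_mul] at hle
  have hx : ∀ v, waveSign H (s + 1) g v = 1 ∨ waveSign H (s + 1) g v = -1 := by
    intro v
    refine (Real.sign_apply_eq_of_ne_zero _ fun h => hg ?_).symm
    exact Set.mem_iUnion.2 ⟨v, h⟩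
  have hcut := le_four_mul_bisectionSize_antiMajority hnbr hID hx hI
  obtain ⟨S, hS, hSle⟩ := exists_bisection_of_signs hdeg hcard
    (antiMajority_eq_one_or hnbr hID hx)
  refine ⟨S, hS, le_trans ?_ hSle⟩
  simp only [improvedSign] at hle h4
  set M := ∑ v ∈ D, antiMajority H I (waveSign H (s + 1) g) v
  have hM : 3 / 2 * |M| ≤ t * M ^ 2 + 9 / (16 * t) := by
    have h5 : t * M ^ 2 + 9 / (16 * t) - 3 / 2 * |M| = (4 * t * |M| - 3) ^ 2 / (16 * t) := by
      rw [← sq_abs]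
      field_simp
      ring
    have h6 : 0 ≤ (4 * t * |M| - 3) ^ 2 / (16 * t) := by positivity
    linarith
  have hIcard' : (D.card : ℝ) ≤ 4 * I.card := by exact_mod_cast hIcard
  have h7 := mul_le_mul_of_nonneg_right hIcard' hgain
  have h8 := mul_le_mul_of_nonneg_left h4 ht.le
  unfold majorityGain at *
  nlinarith

end FiniteBound

section Limit

lemma tendsto_linear_ratio (a b : ℝ) :
    Tendsto (fun s : ℕ => (a * (s + 1) + b) / (1 + 3 * ((s : ℝ) + 1) / 2)) atTop
      (nhds (a / (3 / 2))) := by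
  have hs : Tendsto (fun s : ℕ => ((s : ℝ) + 1)⁻¹) atTop (nhds 0) :=
    tendsto_inv_atTop_zero.comp (tendsto_atTop_add_const_right _ _ tendsto_natCast_atTop_atTop)
  have h : Tendsto (fun s : ℕ => (a + b * ((s : ℝ) + 1)⁻¹) / (((s : ℝ) + 1)⁻¹ + 3 / 2)) atTop
      (nhds ((a + b * 0) / (0 + 3 / 2))) :=
    ((hs.const_mul b).const_add a).div (hs.add_const _) (by norm_num)
  rw [mul_zero, add_zero, zero_add] at h
  refine h.congr fun s => ?_
  have : (0 : ℝ) < s + 1 := by positivity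
  field_simp

lemma tendsto_edgeCorr :
    Tendsto edgeCorr atTop (nhds (1 - 2 * arccos (-(2 * √2 / 3)) / π)) := by
  have h := tendsto_linear_ratio (-√2) 0
  simp only [add_zero] at h
  rw [show -√2 / (3 / 2) = -(2 * √2 / 3) by ring] at h
  exact ((((continuous_arccos.tendsto _).comp h).const_mul 2).div_const π).const_sub 1

lemma tendsto_pairCorr : Tendsto pairCorr atTop (nhds (1 - 2 * arccos (5 / 6) / π)) := by
  have h := tendsto_linear_ratio (5 / 4) (-(3 / 4))
  rw [show (5 / 4 : ℝ) / (3 / 2) = 5 / 6 by norm_num] at h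
  have h' := ((((continuous_arccos.tendsto _).comp h).const_mul 2).div_const π).const_sub 1
  refine h'.congr fun s => ?_
  simp only [Function.comp_apply, pairCorr]
  rw [show (5 / 4 : ℝ) * (s + 1) + -(3 / 4) = (5 * s + 2) / 4 by ring]

lemma arccos_five_sixths_lt : arccos (5 / 6) < 2 * arccos (2 * √2 / 3) := by
  have h1 : 2 * √2 / 3 ≤ 1 := by
    have := Real.sqrt_le_sqrt (show (2 : ℝ) ≤ (3 / 2) ^ 2 by norm_num)
    rw [Real.sqrt_sq (by norm_num)] at this
    linarith
  have h0 : 0 ≤ 2 * √2 / 3 := by positivity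
  have hcos : cos (2 * arccos (2 * √2 / 3)) = 7 / 9 := by
    rw [cos_two_mul, cos_arccos (by linarith) h1, div_pow, mul_pow, Real.sq_sqrt (by norm_num)]
    norm_num
  have h2 := arccos_le_pi_div_two.2 h0
  rw [← arccos_cos (x := 2 * arccos (2 * √2 / 3)) (by linarith [arccos_nonneg (2 * √2 / 3)])
    (by linarith), hcos]
  exact strictAntiOn_arccos (by norm_num) (by norm_num) (by norm_num)

/-- The limiting gain. -/
noncomputable def limitGain : ℝ :=
  1 + (1 - 2 * arccos (5 / 6) / π) + 2 * (1 - 2 * arccos (-(2 * √2 / 3)) / π)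

lemma limitGain_pos : 0 < limitGain := by
  have h : limitGain = 2 * (2 * arccos (2 * √2 / 3) - arccos (5 / 6)) / π := by
    rw [limitGain, arccos_neg]
    field_simp
    ring
  rw [h]
  have := arccos_five_sixths_lt
  have := pi_pos
  apply div_pos <;> linarith

lemma tendsto_majorityGain : Tendsto majorityGain atTop (nhds limitGain) :=
  (tendsto_pairCorr.const_add 1).add (tendsto_edgeCorr.const_mul 2)

lemma tendsto_density : Tendsto
    (fun s => 3 / 4 * (1 - edgeCorr s) + 3 / 16 * majorityGain s) atTop
    (nhds (3 / (2 * π) * arccos (-(2 * √2 / 3)) + 3 / 16 * limitGain)) := by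
  have h := ((tendsto_edgeCorr.const_sub 1).const_mul (3 / 4)).add
    (tendsto_majorityGain.const_mul (3 / 16))
  convert h using 2
  ring

end Limit

section Sequence

lemma tendsto_card_of_treelike {V : ℕ → Type*} [∀ k, Fintype (V k)] {G : ∀ k, SimpleGraph (V k)}
    (htree : ∀ r : ℕ, Tendsto
      (fun k => ({x : V k | TreeLikeVtx (G k) 3 r x}.ncard : ℝ) / (Fintype.card (V k)))
      atTop (nhds 1)) : Tendsto (fun k => Fintype.card (V k)) atTop atTop := by
  refine tendsto_atTop.2 fun m => ?_
  filter_upwards [(htree (m + 1)).eventually (lt_mem_nhds one_pos)] with k hk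
  obtain ⟨v, hv⟩ : {x : V k | TreeLikeVtx (G k) 3 (m + 1) x}.Nonempty := by
    by_contra hcon
    rw [Set.not_nonempty_iff_eq_empty.1 hcon] at hk
    simp at hk
  have h1 := TreeLikeVtx.card_ball hv (m := m) (by omega) (by omega)
  have h2 := Set.ncard_le_card {w | ∃ k' ≤ m, AtDist (G k) k' v w}
  have h3 : m ≤ ∑ d ∈ Finset.range m, 2 ^ d := by
    simpa using Finset.card_nsmul_le_sum (Finset.range m) (fun d => 2 ^ d) 1
      fun d _ => Nat.one_le_two_pow
  rw [Nat.card_eq_fintype_card] at h2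
  omega

lemma bisectionSize_le {W : Type*} [Finite W] (H : SimpleGraph W) (S : Set W) :
    bisectionSize H S ≤ H.edgeSet.ncard :=
  Set.ncard_le_ncard (fun _ he => he.1) (Set.toFinite _)

lemma le_sSup_bisection {W : Type*} [Finite W] {H : SimpleGraph W} {S : Set W}
    (hS : IsBisection S) (n : ℝ) : (bisectionSize H S : ℝ) / n ≤
      sSup {q : ℝ | ∃ S : Set W, IsBisection S ∧ q = (bisectionSize H S : ℝ) / n} := by
  refine le_csSup ((Set.finite_range fun S : Set W => (bisectionSize H S : ℝ) / n).subset
    ?_).bddAbove ⟨S, hS, rfl⟩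
  rintro q ⟨S, -, rfl⟩
  exact ⟨S, rfl⟩

end Sequence

/-- If the random weak limit of finite graphs `G k` is the 3-regular tree and the average
degree tends to 3, then the asymptotic maximum bisection is strictly greater than
`(3/(2π)) arccos(-2√2/3)`. -/
theorem maxBisection_gt_of_cubic_treelike (V : ℕ → Type) [∀ k, Fintype (V k)]
    (G : ∀ k, SimpleGraph (V k))
    (htree : ∀ r : ℕ, Tendsto
      (fun k => ({x : V k | TreeLikeVtx (G k) 3 r x}.ncard : ℝ) / (Fintype.card (V k)))
      atTop (nhds 1))
    (hdeg : Tendsto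
      (fun k => 2 * (((G k).edgeSet.ncard : ℝ)) / (Fintype.card (V k)))
      atTop (nhds 3)) :
    liminf (fun k => sSup {q : ℝ | ∃ S : Set (V k), IsBisection S ∧
        q = (bisectionSize (G k) S : ℝ) / (Fintype.card (V k))}) atTop
      > (3 / (2 * π)) * Real.arccos (-(2 * Real.sqrt 2 / 3)) := by
  classical
  set τ := (3 / (2 * π)) * Real.arccos (-(2 * Real.sqrt 2 / 3))
  have hδ := limitGain_pos
  set δ := limitGain
  obtain ⟨s, hs1, hs2⟩ := ((tendsto_density.eventually
    (lt_mem_nhds (show τ + δ / 8 < τ + 3 / 16 * δ by linarith))).and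
    (tendsto_majorityGain.eventually (lt_mem_nhds hδ))).exists
  set L := 3 / 4 * (1 - edgeCorr s) + 3 / 16 * majorityGain s
  set B : ℕ := 1 + 3 * ∑ d ∈ Finset.range (2 * (s + 1) + 2), 2 ^ d
  have hB : (0 : ℝ) < B := by positivity
  set t := δ / 32 / B
  have ht : 0 < t := by positivity
  have htB : t * B = δ / 32 := div_mul_cancel₀ _ hB.ne'
  have hp := htree (2 * (s + 1) + 2)
  have hn : Tendsto (fun k => ((Fintype.card (V k) : ℝ))⁻¹) atTop (nhds 0) :=
    tendsto_inv_atTop_zero.comp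
      (tendsto_natCast_atTop_atTop.comp (tendsto_card_of_treelike htree))
  have hlim := (((hp.mul_const L).sub (hp.mul_const (δ / 32))).sub
    (hn.const_mul (9 / (16 * t)))).sub ((hp.const_sub 1).const_mul (3 / 2))
  have hev := hlim.eventually (lt_mem_nhds (show τ + δ / 16 < _ by linarith))
  refine lt_of_lt_of_le (show τ < τ + δ / 16 by linarith) (le_liminf_of_le ?_ ?_)
  · refine IsBoundedUnder.isCoboundedUnder_ge ⟨2, ?_⟩
    rw [eventually_map]
    filter_upwards [hdeg.eventually (gt_mem_nhds (show (3 : ℝ) < 4 by norm_num))] with k hk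
    refine Real.sSup_le ?_ (by norm_num)
    rintro q ⟨S, -, rfl⟩
    have h1 : (bisectionSize (G k) S : ℝ) ≤ (G k).edgeSet.ncard := by
      exact_mod_cast bisectionSize_le (G k) S
    have h2 : (bisectionSize (G k) S : ℝ) / Fintype.card (V k) ≤
        (G k).edgeSet.ncard / Fintype.card (V k) := by gcongr
    rw [mul_div_assoc] at hk
    linarith
  · filter_upwards [hev, hp.eventually (lt_mem_nhds (show (1 / 2 : ℝ) < 1 by norm_num)),
      (tendsto_card_of_treelike htree).eventually (eventually_gt_atTop 0)] with k hk hk' hpos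
    set D : Finset (V k) := {x : V k | TreeLikeVtx (G k) 3 (2 * (s + 1) + 2) x}.toFinset
    have hDcard : {x : V k | TreeLikeVtx (G k) 3 (2 * (s + 1) + 2) x}.ncard = D.card :=
      Set.ncard_eq_toFinset_card' _
    rw [hDcard] at hk hk'
    have hpos' : (0 : ℝ) < Fintype.card (V k) := by exact_mod_cast hpos
    rw [lt_div_iff₀ hpos'] at hk'
    obtain ⟨S, hS, hle⟩ := exists_bisection_ge (H := G k) (D := D) (s := s)
      (fun v hv => by simpa [D] using hv) (by
        have : (Fintype.card (V k) : ℝ) ≤ (2 * D.card : ℕ) := by push_cast; linarith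
        exact_mod_cast this) hs2.le ht
    refine le_trans ?_ (le_sSup_bisection hS _)
    refine hk.le.trans ?_
    rw [le_div_iff₀ hpos']
    refine le_trans (le_of_eq ?_) hle
    rw [← htB]
    field_simp
    ring
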